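/- Let R be a Cohen–Macaulay commutative noetherian local ring of Krull dimension d, let M be a nonzero totally reflexive R-module and N a nonzero finitely generated R-module. Fix a finite free presentation F₁ → F₀ → M → 0 and let T be its transpose (the cokernel of the induced map Hom_R(F₀,R) → Hom_R(F₁,R)). If Ext^j_R(T,N) = 0 for all 1 ≤ j ≤ d, then either M ⊗_R N is maximal Cohen–Macaulay (i.e. depth_R(M ⊗_R N) = d) or depth_R(M ⊗_R N) = depth_R(N). -/

import Mathlib

open CategoryTheory

universe u

/-- The `i`-th Ext module `Ext_R^i(M, N)` of `R`-modules `M` and `N`. -/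
noncomputable def extModule (R : Type u) [CommRing R] (M N : Type u)
    [AddCommGroup M] [Module R M] [AddCommGroup N] [Module R N] (i : ℕ) : ModuleCat.{u} R :=
  ((Ext R (ModuleCat.{u} R) i).obj (Opposite.op (ModuleCat.of R M))).obj (ModuleCat.of R N)

/-- The `i`-th Tor module `Tor^R_i(M, N)` of `R`-modules `M` and `N`. -/
noncomputable def torModule (R : Type u) [CommRing R] (M N : Type u)
    [AddCommGroup M] [Module R M] [AddCommGroup N] [Module R N] (i : ℕ) : ModuleCat.{u} R :=
  ((Tor (ModuleCat.{u} R) i).obj (ModuleCat.of R M)).obj (ModuleCat.of R N)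

/-- The depth of a module `M` over a local ring `R`:
`inf { i | Ext^i_R(k, M) ≠ 0 }` where `k` is the residue field, an element of `ℕ∞`
(the zero module has depth `⊤`, since the infimum of the empty set in `ℕ∞` is `⊤`). -/
noncomputable def moduleDepth (R : Type u) [CommRing R] [IsLocalRing R] (M : Type u)
    [AddCommGroup M] [Module R M] : ℕ∞ :=
  sInf {i : ℕ∞ | ∃ n : ℕ, i = (n : ℕ∞) ∧
    Nontrivial (extModule R (IsLocalRing.ResidueField R) M n)}

/-- A module `M` is totally reflexive if the canonical evaluation map `M → M**` is bijective
and `Ext^i_R(M, R) = 0 = Ext^i_R(M*, R)` for all `i > 0`. -/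
def IsTotallyReflexive (R : Type u) [CommRing R] (M : Type u)
    [AddCommGroup M] [Module R M] : Prop :=
  Function.Bijective (Module.Dual.eval R M) ∧
    (∀ i : ℕ, 0 < i → Subsingleton (extModule R M R i)) ∧
    (∀ i : ℕ, 0 < i → Subsingleton (extModule R (Module.Dual R M) R i))

/-- A module `P` has finite projective dimension iff for some `n`, `Ext^i_R(P, -)` vanishes
for all `i > n`. -/
def HasFiniteProjectiveDimension (R : Type u) [CommRing R] (P : Type u)
    [AddCommGroup P] [Module R P] : Prop :=
  ∃ n : ℕ, ∀ (N : Type u) [AddCommGroup N] [Module R N] (i : ℕ), n < i →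
    Subsingleton (extModule R P N i)

/-- A module `Q` has finite injective dimension iff for some `n`, `Ext^i_R(-, Q)` vanishes
for all `i > n`. -/
def HasFiniteInjectiveDimension (R : Type u) [CommRing R] (Q : Type u)
    [AddCommGroup Q] [Module R Q] : Prop :=
  ∃ n : ℕ, ∀ (N : Type u) [AddCommGroup N] [Module R N] (i : ℕ), n < i →
    Subsingleton (extModule R N Q i)

open IsLocalRing TensorProduct

section Ext

open Abelian

lemma subsingleton_ext_functor_iff_of_projectiveResolution {R : Type u} [CommRing R] {X Y : ModuleCat.{u} R}
    (P : ProjectiveResolution X) (n p : ℕ) (hp : (ComplexShape.up ℕ).prev n = p) :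
    Subsingleton (((Ext R (ModuleCat.{u} R) n).obj (Opposite.op X)).obj Y) ↔
      ∀ f : P.complex.X n ⟶ Y, P.complex.d (n + 1) n ≫ f = 0 →
        ∃ g : P.complex.X p ⟶ Y, P.complex.d n p ≫ g = f := by
  rw [← ModuleCat.isZero_iff_subsingleton, (P.isoExt (R := R) n Y).isZero_iff,
    ← HomologicalComplex.exactAt_iff_isZero_homology,
    HomologicalComplex.exactAt_iff' _ p n (n + 1) hp (by simp),
    ShortComplex.moduleCat_exact_iff]
  rfl

lemma subsingleton_ext_functor_iff {R : Type u} [CommRing R] (X Y : ModuleCat.{u} R) (n : ℕ) :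
    Subsingleton (((Ext R (ModuleCat.{u} R) n).obj (Opposite.op X)).obj Y) ↔
      Subsingleton (Abelian.Ext X Y n) := by
  let P := projectiveResolution X
  cases n with
  | zero =>
    rw [subsingleton_ext_functor_iff_of_projectiveResolution P 0 0 (by simp), Ext.addEquiv₀.subsingleton_congr]
    constructor
    · intro H
      refine subsingleton_of_forall_eq 0 fun c => ?_
      let π : P.complex.X 0 ⟶ X := P.π.f 0
      have hπ : P.complex.d 1 0 ≫ π = 0 := P.complex_d_comp_π_f_zero
      have : Epi π := inferInstanceAs (Epi (P.π.f 0))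
      obtain ⟨g, hg⟩ := H (π ≫ c) (by rw [zero_add, reassoc_of% hπ, Limits.zero_comp])
      rw [P.complex.shape _ _ (by simp), Limits.zero_comp] at hg
      exact Limits.zero_of_epi_comp π hg.symm
    · intro H f hf
      refine ⟨0, ?_⟩
      rw [Limits.comp_zero, ← P.exact₀.g_desc f hf]
      have h : P.exact₀.desc f hf = 0 :=
        Subsingleton.elim (α := X ⟶ Y) (P.exact₀.desc f hf) 0
      rw [h]
      exact (Limits.comp_zero).symm
  | succ n =>
    rw [subsingleton_ext_functor_iff_of_projectiveResolution P (n + 1) n (by simp)]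
    constructor
    · intro H
      refine subsingleton_of_forall_eq 0 fun a => ?_
      obtain ⟨f, hf, rfl⟩ := P.extMk_surjective a (n + 2) rfl
      exact (P.extMk_eq_zero_iff f _ rfl hf n rfl).2 (H f hf)
    · intro H f hf
      exact (P.extMk_eq_zero_iff f _ rfl hf n rfl).1 (Subsingleton.elim _ _)

end Ext

lemma subsingleton_extModule_iff (R : Type u) [CommRing R] (M N : Type u)
    [AddCommGroup M] [Module R M] [AddCommGroup N] [Module R N] (i : ℕ) :
    Subsingleton (extModule R M N i) ↔
      Subsingleton (Abelian.Ext (ModuleCat.of R M) (ModuleCat.of R N) i) :=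
  subsingleton_ext_functor_iff _ _ _

lemma natCast_le_moduleDepth_iff (R : Type u) [CommRing R] [IsLocalRing R] (M : Type u)
    [AddCommGroup M] [Module R M] (n : ℕ) :
    (n : ℕ∞) ≤ moduleDepth R M ↔ ∀ i < n,
      Subsingleton (Abelian.Ext (ModuleCat.of R (ResidueField R)) (ModuleCat.of R M) i) := by
  simp only [← subsingleton_extModule_iff, moduleDepth, le_sInf_iff, Set.mem_ofPred_eq]
  constructor
  · intro H i hi
    by_contra h
    rw [not_subsingleton_iff_nontrivial] at h
    have := H i ⟨i, rfl, h⟩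
    exact absurd hi (not_lt.2 (by exact_mod_cast this))
  · rintro H _ ⟨i, rfl, h⟩
    by_contra h'
    exact not_subsingleton_iff_nontrivial.2 h (H i (by simpa using h'))

lemma moduleDepth_eq_top (R : Type u) [CommRing R] [IsLocalRing R] (M : Type u)
    [AddCommGroup M] [Module R M] [Subsingleton M] : moduleDepth R M = ⊤ := by
  refine ENat.eq_top_iff_forall_ge.2 fun n => (natCast_le_moduleDepth_iff R M n).2 fun i _ => ?_
  refine subsingleton_of_forall_eq 0 fun x => ?_
  have h : 𝟙 (ModuleCat.of R M) = 0 := by ext y; exact Subsingleton.elim _ _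
  rw [← x.comp_mk₀_id, h]
  simp

lemma moduleDepth_congr {R : Type u} [CommRing R] [IsLocalRing R] {M N : Type u}
    [AddCommGroup M] [Module R M] [AddCommGroup N] [Module R N] (e : M ≃ₗ[R] N) :
    moduleDepth R M = moduleDepth R N := by
  have key : ∀ n, Nontrivial (extModule R (ResidueField R) M n) ↔
      Nontrivial (extModule R (ResidueField R) N n) := fun n =>
    (((Ext R (ModuleCat.{u} R) n).obj (Opposite.op (ModuleCat.of R (ResidueField R)))).mapIso
      e.toModuleIso).toLinearEquiv.toEquiv.nontrivial_congr
  simp only [moduleDepth, key]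

lemma one_le_moduleDepth_iff (R : Type u) [CommRing R] [IsLocalRing R] (M : Type u)
    [AddCommGroup M] [Module R M] :
    1 ≤ moduleDepth R M ↔ Subsingleton (ResidueField R →ₗ[R] M) := by
  have := natCast_le_moduleDepth_iff R M 1
  simp only [Nat.cast_one, Nat.lt_one_iff, forall_eq] at this
  rw [this]
  exact (Abelian.Ext.addEquiv₀.toEquiv.trans ModuleCat.homEquiv).subsingleton_congr

lemma one_le_moduleDepth_of_injective {R : Type u} [CommRing R] [IsLocalRing R] {M N : Type u}
    [AddCommGroup M] [Module R M] [AddCommGroup N] [Module R N] (f : M →ₗ[R] N)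
    (hf : Function.Injective f) (h : 1 ≤ moduleDepth R N) : 1 ≤ moduleDepth R M := by
  rw [one_le_moduleDepth_iff] at h ⊢
  exact ⟨fun a b => LinearMap.ext fun y => hf <|
    LinearMap.congr_fun (Subsingleton.elim (f ∘ₗ a) (f ∘ₗ b)) y⟩

lemma natCast_le_moduleDepth_iff_exists_isRegular (R : Type u) [CommRing R] [IsNoetherianRing R]
    [IsLocalRing R] (M : Type u)
    [AddCommGroup M] [Module R M] [Module.Finite R M] [Nontrivial M] (n : ℕ) :
    (n : ℕ∞) ≤ moduleDepth R M ↔ ∃ rs : List R, rs.length = n ∧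
      (∀ r ∈ rs, r ∈ maximalIdeal R) ∧ RingTheory.Sequence.IsRegular M rs := by
  have smul_lt : maximalIdeal R • (⊤ : Submodule R M) < ⊤ :=
    (Submodule.top_ne_ideal_smul_of_le_jacobson_annihilator
      (maximalIdeal_le_jacobson _)).symm.lt_top
  have supp : Module.support R (ResidueField R) =
      PrimeSpectrum.zeroLocus (maximalIdeal R) := by
    have := Ideal.annihilator_quotient (I := maximalIdeal R)
    rw [Module.support_eq_zeroLocus]
    exact congrArg (fun I : Ideal R => PrimeSpectrum.zeroLocus (I : Set R)) this
  rw [natCast_le_moduleDepth_iff]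
  constructor
  · intro H
    exact ModuleCat.exists_isRegular_of_exists_subsingleton_ext _ n (ModuleCat.of R M) smul_lt
      (ModuleCat.of R (ResidueField R)) supp H
  · rintro ⟨rs, rfl, hmem, hreg⟩
    exact ModuleCat.subsingleton_ext_of_exists_isRegular _ (ModuleCat.of R (ResidueField R))
      supp.subset (ModuleCat.of R M) smul_lt rs hmem hreg

open RingTheory.Sequence in
lemma moduleDepth_le_ringKrullDim (R : Type u) [CommRing R] [IsNoetherianRing R]
    [IsLocalRing R] (M : Type u)
    [AddCommGroup M] [Module R M] [Module.Finite R M] [Nontrivial M] (d : ℕ)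
    (hd : ringKrullDim R = d) : moduleDepth R M ≤ d := by
  by_contra! h
  have h' : ((d + 1 : ℕ) : ℕ∞) ≤ moduleDepth R M := by
    push_cast
    exact Order.add_one_le_of_lt h
  obtain ⟨rs, hlen, hmem, hreg⟩ := (natCast_le_moduleDepth_iff_exists_isRegular R M _).1 h'
  have h1 := Module.supportDim_add_length_eq_supportDim_of_isRegular rs hreg
  have h2 := Module.supportDim_le_ringKrullDim R M
  have h3 : Nontrivial (M ⧸ (Ideal.ofList rs • ⊤ : Submodule R M)) :=
    Submodule.Quotient.nontrivial_iff.2 hreg.top_ne_smul.symm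
  have h3' := Module.nonempty_support_iff (R := R).2 h3 |>.to_subtype
  have h4 : (0 : WithBot ℕ∞) ≤ Module.supportDim R (M ⧸ (Ideal.ofList rs • ⊤ : Submodule R M)) :=
    Order.krullDim_nonneg
  have h5 : ((d + 1 : ℕ) : WithBot ℕ∞) ≤ (d : ℕ) := by
    rw [← hd, ← hlen]
    refine le_trans ?_ (h1.le.trans h2)
    simpa using add_le_add_left h4 (rs.length : WithBot ℕ∞)
  have h6 : d + 1 ≤ d := by exact_mod_cast h5
  omega

open Pointwise

lemma natCast_succ_le_moduleDepth_iff_quotSMulTop (R : Type u) [CommRing R] [IsNoetherianRing R]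
    [IsLocalRing R] (M : Type u)
    [AddCommGroup M] [Module R M] [Module.Finite R M] (x : R)
    (hx : x ∈ maximalIdeal R) (hreg : IsSMulRegular M x) (n : ℕ) :
    ((n + 1 : ℕ) : ℕ∞) ≤ moduleDepth R M ↔ (n : ℕ∞) ≤ moduleDepth R (QuotSMulTop x M) := by
  constructor
  · intro H
    rw [natCast_le_moduleDepth_iff] at H ⊢
    intro i hi
    have zero1 := AddCommGrpCat.isZero_of_iff_subsingleton.mpr (H i (by omega))
    have zero2 := AddCommGrpCat.isZero_of_iff_subsingleton.mpr (H (i + 1) (by omega))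
    exact AddCommGrpCat.subsingleton_of_isZero <| ShortComplex.Exact.isZero_of_both_zeros
      ((Abelian.Ext.covariant_sequence_exact₃' (ModuleCat.of R (ResidueField R))
        (IsSMulRegular.smulShortComplex_shortExact (M := ModuleCat.of R M) hreg)) i (i + 1) rfl)
      (zero1.eq_zero_of_src _) (zero2.eq_zero_of_tgt _)
  · rcases subsingleton_or_nontrivial M with hM | hM
    · simp [moduleDepth_eq_top]
    have := nontrivial_quotSMulTop_of_mem_maximalIdeal M hx
    rw [natCast_le_moduleDepth_iff_exists_isRegular, natCast_le_moduleDepth_iff_exists_isRegular]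
    rintro ⟨rs, rfl, hmem, h⟩
    exact ⟨x :: rs, by simp, by simpa only [List.forall_mem_cons] using ⟨hx, hmem⟩, by simpa using ⟨hreg, h⟩⟩

lemma exists_isSMulRegular_of_one_le_moduleDepth {R : Type u} [CommRing R] [IsNoetherianRing R]
    [IsLocalRing R] {M : Type u} [AddCommGroup M] [Module R M] [Module.Finite R M]
    (h : 1 ≤ moduleDepth R M) : ∃ x ∈ maximalIdeal R, IsSMulRegular M x := by
  rcases subsingleton_or_nontrivial M with hM | hM
  · exact ⟨0, zero_mem _, fun _ _ _ => Subsingleton.elim _ _⟩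
  obtain ⟨rs, hlen, hmem, hreg⟩ := (natCast_le_moduleDepth_iff_exists_isRegular R M 1).1
    (by simpa using h)
  obtain ⟨x, rfl⟩ := List.length_eq_one_iff.1 hlen
  exact ⟨x, hmem x (by simp), ((RingTheory.Sequence.isRegular_cons_iff _ _ _).1 hreg).1⟩

section Hom

variable {R : Type u} [CommRing R] {X N : Type u}
  [AddCommGroup X] [Module R X] [AddCommGroup N] [Module R N]

lemma isSMulRegular_linearMap {x : R} (hx : IsSMulRegular N x) :
    IsSMulRegular (X →ₗ[R] N) x :=
  fun _ _ h => LinearMap.ext fun y => hx (LinearMap.congr_fun h y)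

lemma ker_compRight_mkQ {x : R} (hx : IsSMulRegular N x) :
    LinearMap.ker (LinearMap.compRight R (M := X) (x • (⊤ : Submodule R N)).mkQ) =
      x • (⊤ : Submodule R (X →ₗ[R] N)) := by
  ext φ
  rw [Submodule.mem_smul_pointwise_iff_exists]
  constructor
  · intro h
    have h' : ∀ y, ∃ z, x • z = φ y := fun y => by
      have : φ y ∈ x • (⊤ : Submodule R N) := by
        rw [← Submodule.Quotient.mk_eq_zero]
        exact LinearMap.congr_fun h y
      rw [Submodule.mem_smul_pointwise_iff_exists] at this
      obtain ⟨z, -, hz⟩ := this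
      exact ⟨z, hz⟩
    choose ψ hψ using h'
    refine ⟨⟨⟨ψ, fun a b => hx ?_⟩, fun r a => hx ?_⟩, trivial, LinearMap.ext hψ⟩
    · simp only [smul_add, hψ, map_add]
    · simp only [RingHom.id_apply, smul_comm x r, hψ, map_smul]
  · rintro ⟨ψ, -, rfl⟩
    ext y
    exact (Submodule.Quotient.mk_eq_zero _).2
      (Submodule.smul_mem_pointwise_smul _ _ _ trivial)

/-- If `Ext^1(Y, X₁)` vanishes, every map `Y ⟶ X₃` lifts to `X₂`. -/
lemma exists_lift_of_subsingleton_ext_one {S : ShortComplex (ModuleCat.{u} R)}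
    (hS : S.ShortExact) (Y : ModuleCat.{u} R) (h : Subsingleton (Abelian.Ext Y S.X₁ 1))
    (φ : Y ⟶ S.X₃) : ∃ ψ : Y ⟶ S.X₂, ψ ≫ S.g = φ := by
  obtain ⟨x, hx⟩ := Abelian.Ext.covariant_sequence_exact₃ Y hS (Abelian.Ext.mk₀ φ) (zero_add 1)
    (Subsingleton.elim _ _)
  obtain ⟨ψ, rfl⟩ := (Abelian.Ext.mk₀_bijective _ _).2 x
  refine ⟨ψ, (Abelian.Ext.mk₀_bijective _ _).1 ?_⟩
  rw [← hx, Abelian.Ext.mk₀_comp_mk₀]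

/-- If `Ext^1(X₃, Y)` vanishes, every map `X₁ ⟶ Y` extends to `X₂`. -/
lemma exists_extension_of_subsingleton_ext_one {S : ShortComplex (ModuleCat.{u} R)}
    (hS : S.ShortExact) (Y : ModuleCat.{u} R) (h : Subsingleton (Abelian.Ext S.X₃ Y 1))
    (φ : S.X₁ ⟶ Y) : ∃ ψ : S.X₂ ⟶ Y, S.f ≫ ψ = φ := by
  obtain ⟨x, hx⟩ := Abelian.Ext.contravariant_sequence_exact₁ hS Y (Abelian.Ext.mk₀ φ) (add_zero 1)
    (Subsingleton.elim _ _)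
  obtain ⟨ψ, rfl⟩ := (Abelian.Ext.mk₀_bijective _ _).2 x
  refine ⟨ψ, (Abelian.Ext.mk₀_bijective _ _).1 ?_⟩
  rw [← hx, Abelian.Ext.mk₀_comp_mk₀]

lemma exists_injective_quotSMulTop_linearMap {x : R} (hx : IsSMulRegular N x) :
    ∃ f : QuotSMulTop x (X →ₗ[R] N) →ₗ[R] (X →ₗ[R] QuotSMulTop x N), Function.Injective f :=
  ⟨Submodule.liftQ _ (LinearMap.compRight R (M := X) (x • (⊤ : Submodule R N)).mkQ)
    (ker_compRight_mkQ hx).ge, LinearMap.ker_eq_bot.1 <|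
      Submodule.ker_liftQ_eq_bot _ _ _ (ker_compRight_mkQ hx).le⟩

lemma nonempty_quotSMulTop_linearMap_equiv {x : R} (hx : IsSMulRegular N x)
    (h : Subsingleton (Abelian.Ext (ModuleCat.of R X) (ModuleCat.of R N) 1)) :
    Nonempty (QuotSMulTop x (X →ₗ[R] N) ≃ₗ[R] (X →ₗ[R] QuotSMulTop x N)) := by
  refine ⟨(Submodule.quotEquivOfEq _ _ (ker_compRight_mkQ hx).symm).trans
    (LinearMap.quotKerEquivOfSurjective _ fun φ => ?_)⟩
  obtain ⟨ψ, hψ⟩ := exists_lift_of_subsingleton_ext_one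
    (IsSMulRegular.smulShortComplex_shortExact (M := ModuleCat.of R N) hx) (ModuleCat.of R X) h
    (ModuleCat.ofHom φ)
  exact ⟨ψ.hom, congrArg ModuleCat.Hom.hom hψ⟩

lemma subsingleton_ext_quotSMulTop {x : R} (hx : IsSMulRegular N x) (i : ℕ)
    (h : Subsingleton (Abelian.Ext (ModuleCat.of R X) (ModuleCat.of R N) i))
    (h' : Subsingleton (Abelian.Ext (ModuleCat.of R X) (ModuleCat.of R N) (i + 1))) :
    Subsingleton (Abelian.Ext (ModuleCat.of R X) (ModuleCat.of R (QuotSMulTop x N)) i) := by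
  have zero1 := AddCommGrpCat.isZero_of_iff_subsingleton.mpr h
  have zero2 := AddCommGrpCat.isZero_of_iff_subsingleton.mpr h'
  exact AddCommGrpCat.subsingleton_of_isZero <| ShortComplex.Exact.isZero_of_both_zeros
    ((Abelian.Ext.covariant_sequence_exact₃' (ModuleCat.of R X)
      (IsSMulRegular.smulShortComplex_shortExact (M := ModuleCat.of R N) hx)) i (i + 1) rfl)
    (zero1.eq_zero_of_src _) (zero2.eq_zero_of_tgt _)

variable [IsLocalRing R]

lemma one_le_moduleDepth_linearMap (h : 1 ≤ moduleDepth R N) :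
    1 ≤ moduleDepth R (X →ₗ[R] N) := by
  rw [one_le_moduleDepth_iff] at h ⊢
  refine subsingleton_of_forall_eq 0 fun φ => ?_
  ext a y
  exact LinearMap.congr_fun (Subsingleton.elim (φ.flip y) 0) a

lemma exists_linearMap_residueField_ne_zero [Module.Finite R X] [Nontrivial X] :
    ∃ π : X →ₗ[R] ResidueField R, π ≠ 0 := by
  have hV : Nontrivial (ResidueField R ⊗[R] X) := by
    rwa [← not_subsingleton_iff_nontrivial, IsLocalRing.subsingleton_tensorProduct,
      not_subsingleton_iff_nontrivial]
  by_contra! H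
  obtain ⟨v, hv⟩ := exists_ne (0 : ResidueField R ⊗[R] X)
  refine hv ((Module.forall_dual_apply_eq_zero_iff (ResidueField R) v).1 fun f => ?_)
  have hf : f = 0 := by
    ext y
    exact LinearMap.congr_fun (H (f.restrictScalars R ∘ₗ TensorProduct.mk R (ResidueField R) X 1)) y
  simp [hf]

lemma one_le_moduleDepth_of_linearMap [Module.Finite R X] [Nontrivial X] (h : 1 ≤ moduleDepth R (X →ₗ[R] N)) :
    1 ≤ moduleDepth R N := by
  rw [one_le_moduleDepth_iff] at h ⊢
  obtain ⟨π, hπ⟩ := exists_linearMap_residueField_ne_zero (R := R) (X := X)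
  obtain ⟨y, hy⟩ : ∃ y, π y ≠ 0 := by
    by_contra! H
    exact hπ (LinearMap.ext H)
  refine subsingleton_of_forall_eq 0 fun a => LinearMap.ext fun c => ?_
  have h0 : ((LinearMap.mul R (ResidueField R)).compl₂ π).compr₂ a = 0 := Subsingleton.elim _ _
  have h1 := LinearMap.congr_fun₂ h0 (c * (π y)⁻¹) y
  simpa [mul_assoc, hy] using h1

variable [IsNoetherianRing R] [Module.Finite R X]

lemma natCast_le_moduleDepth_linearMap [Module.Finite R N] (j : ℕ)
    (h : (j : ℕ∞) ≤ moduleDepth R N)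
    (hExt : ∀ i, 1 ≤ i → i + 2 ≤ j →
      Subsingleton (Abelian.Ext (ModuleCat.of R X) (ModuleCat.of R N) i)) :
    (j : ℕ∞) ≤ moduleDepth R (X →ₗ[R] N) := by
  induction j generalizing N with
  | zero => simp
  | succ j ih =>
    have h1 : 1 ≤ moduleDepth R N := le_trans (by simp) h
    rcases j.eq_zero_or_pos with rfl | hj
    · simpa using one_le_moduleDepth_linearMap (by simpa using h)
    obtain ⟨x, hxm, hx⟩ := exists_isSMulRegular_of_one_le_moduleDepth h1
    rw [natCast_succ_le_moduleDepth_iff_quotSMulTop _ _ x hxm hx] at h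
    rw [natCast_succ_le_moduleDepth_iff_quotSMulTop _ _ x hxm (isSMulRegular_linearMap hx)]
    have hQ := ih h fun i hi hij => subsingleton_ext_quotSMulTop hx i (hExt i hi (by omega))
      (hExt (i + 1) (by omega) (by omega))
    obtain rfl | hj' : j = 1 ∨ 2 ≤ j := by omega
    · obtain ⟨f, hf⟩ := exists_injective_quotSMulTop_linearMap (X := X) hx
      simpa using one_le_moduleDepth_of_injective f hf (by simpa using hQ)
    · obtain ⟨e⟩ := nonempty_quotSMulTop_linearMap_equiv hx (hExt 1 le_rfl (by omega))
      rwa [moduleDepth_congr e]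

lemma natCast_succ_le_moduleDepth_of_linearMap [Module.Finite R N] [Nontrivial X] (n : ℕ)
    (h : ((n + 1 : ℕ) : ℕ∞) ≤ moduleDepth R (X →ₗ[R] N))
    (hExt : ∀ i, 1 ≤ i → i ≤ n →
      Subsingleton (Abelian.Ext (ModuleCat.of R X) (ModuleCat.of R N) i)) :
    ((n + 1 : ℕ) : ℕ∞) ≤ moduleDepth R N := by
  induction n generalizing N with
  | zero => simpa using one_le_moduleDepth_of_linearMap (by simpa using h)
  | succ n ih =>
    obtain ⟨x, hxm, hx⟩ := exists_isSMulRegular_of_one_le_moduleDepth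
      (one_le_moduleDepth_of_linearMap (le_trans (by simp) h))
    rw [natCast_succ_le_moduleDepth_iff_quotSMulTop _ _ x hxm hx]
    rw [natCast_succ_le_moduleDepth_iff_quotSMulTop _ _ x hxm (isSMulRegular_linearMap hx)] at h
    obtain ⟨e⟩ := nonempty_quotSMulTop_linearMap_equiv hx (hExt 1 le_rfl (by omega))
    rw [moduleDepth_congr e] at h
    exact ih h fun i hi hin => subsingleton_ext_quotSMulTop hx i (hExt i hi (by omega))
      (hExt (i + 1) (by omega) (by omega))

end Hom

section Transpose

lemma subsingleton_ext_of_projective {R : Type u} [CommRing R] {S : ShortComplex (ModuleCat.{u} R)}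
    (hS : S.ShortExact) [Projective S.X₂] (Y : ModuleCat.{u} R) (i : ℕ) (hi : 1 ≤ i)
    (h : Subsingleton (Abelian.Ext S.X₃ Y (i + 1))) : Subsingleton (Abelian.Ext S.X₁ Y i) := by
  refine subsingleton_of_forall_eq 0 fun x => ?_
  obtain ⟨i, rfl⟩ := Nat.exists_eq_add_of_le' hi
  obtain ⟨y, rfl⟩ := Abelian.Ext.contravariant_sequence_exact₁ hS Y x (add_comm 1 _)
    (Subsingleton.elim _ _)
  rw [Abelian.Ext.eq_zero_of_projective y, Abelian.Ext.comp_zero]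

variable {R : Type u} [CommRing R]

/-- The canonical map `M ⊗ N → Hom(M*, N)` sending `m ⊗ n` to `φ ↦ φ(m)n`. -/
noncomputable def tensorToHomDual (R M N : Type*) [CommRing R] [AddCommGroup M] [Module R M]
    [AddCommGroup N] [Module R N] : M ⊗[R] N →ₗ[R] (Module.Dual R M →ₗ[R] N) :=
  dualTensorHom R (Module.Dual R M) N ∘ₗ (Module.Dual.eval R M).rTensor N

lemma tensorToHomDual_tmul {M N : Type*} [AddCommGroup M] [Module R M]
    [AddCommGroup N] [Module R N] (m : M) (n : N) (φ : Module.Dual R M) :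
    tensorToHomDual R M N (m ⊗ₜ n) φ = φ m • n := by
  simp [tensorToHomDual]

lemma tensorToHomDual_rTensor {M M' N : Type*} [AddCommGroup M] [Module R M]
    [AddCommGroup M'] [Module R M'] [AddCommGroup N] [Module R N] (g : M' →ₗ[R] M)
    (z : M' ⊗[R] N) :
    tensorToHomDual R M N (g.rTensor N z) = tensorToHomDual R M' N z ∘ₗ g.dualMap := by
  induction z with
  | zero => simp
  | add x y hx hy => simp only [map_add, hx, hy, LinearMap.add_comp]
  | tmul m n => ext φ; simp [tensorToHomDual_tmul]

lemma tensorToHomDual_bijective {F N : Type*} [AddCommGroup F] [Module R F]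
    [AddCommGroup N] [Module R N] [Module.Free R F] [Module.Finite R F] :
    Function.Bijective (tensorToHomDual R F N) := by
  have h : ⇑(tensorToHomDual R F N) = ⇑(((Module.evalEquiv R F).rTensor N).trans
      (dualTensorHomEquiv R (Module.Dual R F) N)) := by
    ext z : 1
    induction z with
    | zero => simp
    | add x y hx hy => simp only [map_add, hx, hy]
    | tmul m n => simp [tensorToHomDual]
  rw [h]
  exact LinearEquiv.bijective _

variable {M N F₀ F₁ : Type u} [AddCommGroup M] [Module R M] [AddCommGroup N] [Module R N]
  [AddCommGroup F₀] [Module R F₀] [AddCommGroup F₁] [Module R F₁]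
  {f : F₁ →ₗ[R] F₀} {g : F₀ →ₗ[R] M}

lemma range_dualMap_eq_ker_dualMap (hg : Function.Surjective g)
    (hfg : LinearMap.range f = LinearMap.ker g) :
    LinearMap.range g.dualMap = LinearMap.ker f.dualMap := by
  rw [LinearMap.range_dualMap_eq_dualAnnihilator_ker_of_surjective g hg, ← hfg,
    LinearMap.ker_dualMap_eq_dualAnnihilator_range]

variable (f g) in
/-- The sequence `0 → M* → F₀* → im f* → 0` associated with a presentation of `M`. -/
noncomputable def dualPresentationShortComplex (hg : Function.Surjective g)
    (hfg : LinearMap.range f = LinearMap.ker g) : ShortComplex (ModuleCat.{u} R) :=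
  ShortComplex.mk (X₁ := ModuleCat.of R (Module.Dual R M))
      (X₂ := ModuleCat.of R (Module.Dual R F₀))
      (X₃ := ModuleCat.of R (LinearMap.range f.dualMap))
      (ModuleCat.ofHom g.dualMap) (ModuleCat.ofHom f.dualMap.rangeRestrict) <| by
    ext φ : 2
    have : g.dualMap φ ∈ LinearMap.ker f.dualMap :=
      range_dualMap_eq_ker_dualMap hg hfg ▸ LinearMap.mem_range_self _ _
    exact Subtype.ext this

lemma dualPresentationShortComplex_shortExact (hg : Function.Surjective g)
    (hfg : LinearMap.range f = LinearMap.ker g) :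
    (dualPresentationShortComplex f g hg hfg).ShortExact where
  exact := ModuleCat.shortComplex_exact _ <| LinearMap.exact_iff.2 <|
    (LinearMap.ker_rangeRestrict _).trans (range_dualMap_eq_ker_dualMap hg hfg).symm
  mono_f := (ModuleCat.mono_iff_injective _).2 (LinearMap.dualMap_injective_of_surjective hg)
  epi_g := (ModuleCat.epi_iff_surjective _).2 (LinearMap.surjective_rangeRestrict f.dualMap)

variable (f) in
/-- The sequence `0 → im f* → F₁* → T → 0` where `T` is the cokernel of `f*`. -/
noncomputable def transposeShortComplex : ShortComplex (ModuleCat.{u} R) :=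
  ShortComplex.mk (X₁ := ModuleCat.of R (LinearMap.range f.dualMap))
    (X₂ := ModuleCat.of R (Module.Dual R F₁))
    (X₃ := ModuleCat.of R (Module.Dual R F₁ ⧸ LinearMap.range f.dualMap))
    (ModuleCat.ofHom (LinearMap.range f.dualMap).subtype)
    (ModuleCat.ofHom (LinearMap.range f.dualMap).mkQ) (by ext x : 2; simp)

variable (f) in
lemma transposeShortComplex_shortExact : (transposeShortComplex f).ShortExact where
  exact := ModuleCat.shortComplex_exact _ <| LinearMap.exact_iff.2 <|
    (Submodule.ker_mkQ _).trans (Submodule.range_subtype _).symm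
  mono_f := (ModuleCat.mono_iff_injective _).2 (Submodule.injective_subtype _)
  epi_g := (ModuleCat.epi_iff_surjective _).2 (Submodule.mkQ_surjective _)

variable [Module.Free R F₁] [Module.Finite R F₁]

instance : Projective (transposeShortComplex f).X₂ :=
  ModuleCat.projective_of_free (M := ModuleCat.of R (Module.Dual R F₁))
    (Module.Free.chooseBasis R _)

lemma subsingleton_ext_range_dualMap (i : ℕ) (hi : 1 ≤ i)
    (h : Subsingleton (Abelian.Ext (ModuleCat.of R (Module.Dual R F₁ ⧸ LinearMap.range f.dualMap))
      (ModuleCat.of R N) (i + 1))) :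
    Subsingleton (Abelian.Ext (ModuleCat.of R (LinearMap.range f.dualMap))
      (ModuleCat.of R N) i) :=
  subsingleton_ext_of_projective (transposeShortComplex_shortExact f) _ i hi h

variable [Module.Free R F₀] [Module.Finite R F₀]

instance (hg : Function.Surjective g) (hfg : LinearMap.range f = LinearMap.ker g) :
    Projective (dualPresentationShortComplex f g hg hfg).X₂ :=
  ModuleCat.projective_of_free (M := ModuleCat.of R (Module.Dual R F₀))
    (Module.Free.chooseBasis R _)

lemma subsingleton_ext_dual (hg : Function.Surjective g)
    (hfg : LinearMap.range f = LinearMap.ker g) (i : ℕ) (hi : 1 ≤ i)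
    (h : Subsingleton (Abelian.Ext (ModuleCat.of R (Module.Dual R F₁ ⧸ LinearMap.range f.dualMap))
      (ModuleCat.of R N) (i + 2))) :
    Subsingleton (Abelian.Ext (ModuleCat.of R (Module.Dual R M)) (ModuleCat.of R N) i) :=
  subsingleton_ext_of_projective (dualPresentationShortComplex_shortExact hg hfg) _ i hi
    (subsingleton_ext_range_dualMap (i + 1) (by omega) h)

lemma tensorToHomDual_surjective (hg : Function.Surjective g)
    (hfg : LinearMap.range f = LinearMap.ker g)
    (h : Subsingleton (Abelian.Ext (ModuleCat.of R (Module.Dual R F₁ ⧸ LinearMap.range f.dualMap))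
      (ModuleCat.of R N) 2)) :
    Function.Surjective (tensorToHomDual R M N) := by
  intro φ
  obtain ⟨ψ, hψ⟩ := exists_extension_of_subsingleton_ext_one
    (dualPresentationShortComplex_shortExact hg hfg) (ModuleCat.of R N)
    (subsingleton_ext_range_dualMap 1 le_rfl h) (ModuleCat.ofHom φ)
  obtain ⟨z, hz⟩ := (tensorToHomDual_bijective (R := R) (F := F₀) (N := N)).2 ψ.hom
  refine ⟨g.rTensor N z, ?_⟩
  rw [tensorToHomDual_rTensor, hz]
  exact congrArg ModuleCat.Hom.hom hψ

lemma tensorToHomDual_injective (hg : Function.Surjective g)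
    (hfg : LinearMap.range f = LinearMap.ker g)
    (h : Subsingleton (Abelian.Ext (ModuleCat.of R (Module.Dual R F₁ ⧸ LinearMap.range f.dualMap))
      (ModuleCat.of R N) 1)) :
    Function.Injective (tensorToHomDual R M N) := by
  rw [injective_iff_map_eq_zero]
  intro w hw
  obtain ⟨z, rfl⟩ := LinearMap.rTensor_surjective N hg w
  rw [tensorToHomDual_rTensor] at hw
  -- the map `F₀* → N` kills `M*`, so it factors through `im f*`
  have hker : LinearMap.ker f.dualMap ≤ LinearMap.ker (tensorToHomDual R F₀ N z) := by
    rw [← range_dualMap_eq_ker_dualMap hg hfg]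
    rintro _ ⟨φ, rfl⟩
    exact LinearMap.congr_fun hw φ
  let φ : LinearMap.range f.dualMap →ₗ[R] N :=
    (Submodule.liftQ _ _ hker) ∘ₗ f.dualMap.quotKerEquivRange.symm.toLinearMap
  have hφ : ∀ y, φ (f.dualMap.rangeRestrict y) = tensorToHomDual R F₀ N z y := fun y => by
    have : f.dualMap.quotKerEquivRange (Submodule.Quotient.mk y) = f.dualMap.rangeRestrict y := rfl
    simp only [φ, LinearMap.comp_apply, LinearEquiv.coe_coe, ← this, LinearEquiv.symm_apply_apply]
    rfl
  obtain ⟨ψ, hψ⟩ := exists_extension_of_subsingleton_ext_one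
    (transposeShortComplex_shortExact f) (ModuleCat.of R N) h (ModuleCat.ofHom φ)
  obtain ⟨y, hy⟩ := (tensorToHomDual_bijective (R := R) (F := F₁) (N := N)).2 ψ.hom
  have hz : f.rTensor N y = z := by
    refine (tensorToHomDual_bijective (R := R) (F := F₀) (N := N)).1 ?_
    rw [tensorToHomDual_rTensor, hy]
    ext u
    rw [← hφ]
    exact LinearMap.congr_fun (congrArg ModuleCat.Hom.hom hψ) (f.dualMap.rangeRestrict u)
  rw [← hz, ← LinearMap.comp_apply, ← LinearMap.rTensor_comp,
    LinearMap.range_le_ker_iff.1 hfg.le]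
  simp

end Transpose

lemma nontrivial_tensorProduct_of_isLocalRing {R M N : Type*} [CommRing R] [IsLocalRing R]
    [AddCommGroup M] [Module R M] [Module.Finite R M] [Nontrivial M]
    [AddCommGroup N] [Module R N] [Module.Finite R N] [Nontrivial N] :
    Nontrivial (M ⊗[R] N) := by
  have hM : Nontrivial (ResidueField R ⊗[R] M) := by
    rwa [← not_subsingleton_iff_nontrivial, IsLocalRing.subsingleton_tensorProduct,
      not_subsingleton_iff_nontrivial]
  have hN : Nontrivial (ResidueField R ⊗[R] N) := by
    rwa [← not_subsingleton_iff_nontrivial, IsLocalRing.subsingleton_tensorProduct,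
      not_subsingleton_iff_nontrivial]
  rw [← not_subsingleton_iff_nontrivial,
    ← IsLocalRing.subsingleton_tensorProduct (R := R) (M := M ⊗[R] N),
    not_subsingleton_iff_nontrivial]
  exact (AlgebraTensorModule.distribBaseChange R (ResidueField R) M N).toEquiv.nontrivial

/-- **Corollary 3.3.** Let `R` be a Cohen-Macaulay noetherian local ring of Krull dimension
`d`, `M` a nonzero totally reflexive `R`-module and `N` a nonzero finitely generated
`R`-module, with `T` the transpose of a finite free presentation of `M`.  If
`Ext^j_R(T, N) = 0` for `1 ≤ j ≤ d`, then either `M ⊗ N` is maximal Cohen-Macaulay or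
`depth(M ⊗ N) = depth N`. -/
theorem depth_tensor_mcm_or_eq
    (R : Type u) [CommRing R] [IsNoetherianRing R] [IsLocalRing R]
    (d : ℕ) (hdim : ringKrullDim R = d) (hCM : moduleDepth R R = (d : ℕ∞))
    (M N : Type u) [AddCommGroup M] [Module R M] [Module.Finite R M] [Nontrivial M]
    [AddCommGroup N] [Module R N] [Module.Finite R N] [Nontrivial N]
    (hM : IsTotallyReflexive R M)
    (F₀ F₁ : Type u)
    [AddCommGroup F₀] [Module R F₀] [Module.Free R F₀] [Module.Finite R F₀]
    [AddCommGroup F₁] [Module R F₁] [Module.Free R F₁] [Module.Finite R F₁]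
    (f : F₁ →ₗ[R] F₀) (g : F₀ →ₗ[R] M)
    (hg : Function.Surjective g) (hfg : LinearMap.range f = LinearMap.ker g)
    (hExt : ∀ j : ℕ, 1 ≤ j → j ≤ d →
      Subsingleton (extModule R
        (Module.Dual R F₁ ⧸ LinearMap.range (LinearMap.dualMap f)) N j)) :
    moduleDepth R (TensorProduct R M N) = (d : ℕ∞) ∨
      moduleDepth R (TensorProduct R M N) = moduleDepth R N := by
  have hExt' : ∀ j, 1 ≤ j → j ≤ d → Subsingleton (Abelian.Ext
      (ModuleCat.of R (Module.Dual R F₁ ⧸ LinearMap.range f.dualMap)) (ModuleCat.of R N) j) :=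
    fun j h1 h2 => (subsingleton_extModule_iff R _ N j).1 (hExt j h1 h2)
  have : Nontrivial (Module.Dual R M) := by
    by_contra h
    rw [not_nontrivial_iff_subsingleton] at h
    obtain ⟨a, b, hab⟩ := exists_pair_ne M
    exact hab (hM.1.1 (LinearMap.ext fun φ => by simp [Subsingleton.elim φ 0]))
  have e (hd : 2 ≤ d) : M ⊗[R] N ≃ₗ[R] (Module.Dual R M →ₗ[R] N) :=
    LinearEquiv.ofBijective (tensorToHomDual R M N)
      ⟨tensorToHomDual_injective hg hfg (hExt' 1 le_rfl (by omega)),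
        tensorToHomDual_surjective hg hfg (hExt' 2 (by omega) hd)⟩
  have : Nontrivial (M ⊗[R] N) := nontrivial_tensorProduct_of_isLocalRing
  have hle : moduleDepth R (M ⊗[R] N) ≤ d := moduleDepth_le_ringKrullDim R _ d hdim
  have hleN : moduleDepth R N ≤ d := moduleDepth_le_ringKrullDim R _ d hdim
  obtain ⟨n, hn⟩ := ENat.ne_top_iff_exists.1 (ne_top_of_le_ne_top (ENat.natCast_ne_top d) hleN)
  obtain ⟨t, ht⟩ := ENat.ne_top_iff_exists.1 (ne_top_of_le_ne_top (ENat.natCast_ne_top d) hle)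
  have htd : t ≤ d := by rw [← ht] at hle; exact_mod_cast hle
  have hnd : n ≤ d := by rw [← hn] at hleN; exact_mod_cast hleN
  -- `depth (M ⊗ N) ≥ depth N`
  have hnt : n ≤ t := by
    rcases le_or_gt 2 d with hd | hd
    · rw [← ENat.natCast_le_natCast, ht, moduleDepth_congr (e hd)]
      exact natCast_le_moduleDepth_linearMap n hn.le fun i hi hin =>
        subsingleton_ext_dual hg hfg i hi (hExt' _ (by omega) (by omega))
    · rcases n.eq_zero_or_pos with rfl | hpos
      · exact Nat.zero_le _
      have h1 : 1 ≤ moduleDepth R (M ⊗[R] N) :=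
        one_le_moduleDepth_of_injective _ (tensorToHomDual_injective hg hfg
          (hExt' 1 le_rfl (by omega)))
          (one_le_moduleDepth_linearMap (by rw [← hn]; exact_mod_cast hpos))
      rw [← ht] at h1
      have : 1 ≤ t := by exact_mod_cast h1
      omega
  rw [← ht, ← hn, Nat.cast_inj, Nat.cast_inj]
  by_contra! hne
  have hd : 2 ≤ d := by omega
  have h1 : ((n + 1 : ℕ) : ℕ∞) ≤ moduleDepth R N := by
    refine natCast_succ_le_moduleDepth_of_linearMap (X := Module.Dual R M) n ?_ fun i hi hin =>
      subsingleton_ext_dual hg hfg i hi (hExt' _ (by omega) (by omega))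
    rw [← moduleDepth_congr (e hd), ← ht]
    exact_mod_cast (by omega : n + 1 ≤ t)
  rw [← hn] at h1
  have h2 : n + 1 ≤ n := by exact_mod_cast h1
  omega
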